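/- For any smooth compactly supported function f on ℝ², there exists an absolute constant C such that ‖f‖_{L^∞(ℝ²)} ≤ C(‖f‖_{L²(ℝ²)} + ‖∂_x f‖_{L²(ℝ²)} + ‖∂_{yy} f‖_{L²(ℝ²)}). -/

import Mathlib

open MeasureTheory

noncomputable def pdx (f : ℝ × ℝ → ℝ) (z : ℝ × ℝ) : ℝ := fderiv ℝ f z (1, 0)
noncomputable def pdy (f : ℝ × ℝ → ℝ) (z : ℝ × ℝ) : ℝ := fderiv ℝ f z (0, 1)
noncomputable def L2N (f : ℝ × ℝ → ℝ) : ℝ := (∫ z : ℝ × ℝ, (f z) ^ 2) ^ ((1:ℝ)/2)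

theorem pd_smooth (v : ℝ × ℝ) {f : ℝ × ℝ → ℝ} (hf : ContDiff ℝ (⊤ : ℕ∞) f) :
    ContDiff ℝ (⊤ : ℕ∞) (fun z => fderiv ℝ f z v) :=
  (hf.fderiv_right (m := (⊤ : ℕ∞)) (by simp)).clm_apply contDiff_const

theorem pd_supp (v : ℝ × ℝ) {f : ℝ × ℝ → ℝ} (hf : HasCompactSupport f) :
    HasCompactSupport (fun z => fderiv ℝ f z v) :=
  hf.fderiv_apply ℝ v

theorem slice_y_supp {g : ℝ × ℝ → ℝ} (hg : HasCompactSupport g) (x : ℝ) :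
    HasCompactSupport (fun y => g (x, y)) := by
  refine HasCompactSupport.intro (hg.isCompact.image continuous_snd) (fun y hy => ?_)
  by_contra h
  exact hy ⟨(x, y), subset_tsupport _ h, rfl⟩

theorem slice_x_supp {g : ℝ × ℝ → ℝ} (hg : HasCompactSupport g) (y : ℝ) :
    HasCompactSupport (fun x => g (x, y)) := by
  refine HasCompactSupport.intro (hg.isCompact.image continuous_fst) (fun x hx => ?_)
  by_contra h
  exact hx ⟨(x, y), subset_tsupport _ h, rfl⟩

theorem slice_y_int {g : ℝ × ℝ → ℝ} (hc : Continuous g) (hg : HasCompactSupport g) (x : ℝ) :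
    Integrable (fun y => g (x, y)) :=
  Continuous.integrable_of_hasCompactSupport (by fun_prop) (slice_y_supp hg x)

theorem slice_x_int {g : ℝ × ℝ → ℝ} (hc : Continuous g) (hg : HasCompactSupport g) (y : ℝ) :
    Integrable (fun x => g (x, y)) :=
  Continuous.integrable_of_hasCompactSupport (by fun_prop) (slice_x_supp hg y)

theorem hasDeriv_x {g : ℝ × ℝ → ℝ} (hg : ContDiff ℝ (⊤ : ℕ∞) g) (x y : ℝ) :
    HasDerivAt (fun t => g (t, y)) (pdx g (x, y)) x := by
  have h := (hg.differentiable (by simp) (x, y)).hasFDerivAt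
  exact h.comp_hasDerivAt x ((hasDerivAt_id x).prodMk (hasDerivAt_const x y))

theorem hasDeriv_y {g : ℝ × ℝ → ℝ} (hg : ContDiff ℝ (⊤ : ℕ∞) g) (x y : ℝ) :
    HasDerivAt (fun t => g (x, t)) (pdy g (x, y)) y := by
  have h := (hg.differentiable (by simp) (x, y)).hasFDerivAt
  exact h.comp_hasDerivAt y ((hasDerivAt_const y x).prodMk (hasDerivAt_id y))

theorem pd_comm {f : ℝ × ℝ → ℝ} (hf : ContDiff ℝ (⊤ : ℕ∞) f) (z : ℝ × ℝ) :
    pdx (pdy f) z = pdy (pdx f) z := by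
  have hd : DifferentiableAt ℝ (fderiv ℝ f) z :=
    (hf.fderiv_right (m := (⊤ : ℕ∞)) (by simp)).differentiable (by simp) z
  have key : ∀ v w : ℝ × ℝ, fderiv ℝ (fun z => fderiv ℝ f z v) z w
      = fderiv ℝ (fderiv ℝ f) z w v := by
    intro v w
    rw [fderiv_clm_apply hd (differentiableAt_const v)]
    simp
  have hs : IsSymmSndFDerivAt ℝ f z :=
    (contDiff_infty.1 hf 2).contDiffAt.isSymmSndFDerivAt (by simp)
  have h1 := key (0, 1) (1, 0)
  have h2 := key (1, 0) (0, 1)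
  exact h1.trans ((hs.eq _ _).trans h2.symm)

/-- One-dimensional fundamental theorem of calculus for the square. -/
theorem sq_eq {h h' : ℝ → ℝ} (hd : ∀ t, HasDerivAt h (h' t) t) (hc : Continuous h')
    (hs : HasCompactSupport h) (x : ℝ) :
    h x ^ 2 = ∫ t in Set.Iic x, 2 * (h t * h' t) := by
  have hd2 : ∀ t, HasDerivAt (fun t => h t ^ 2) (2 * (h t * h' t)) t := fun t => by
    exact ((hd t).pow 2).congr_deriv (by norm_num; ring)
  have hcont : Continuous h := continuous_iff_continuousAt.2 fun t => (hd t).continuousAt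
  have hder : deriv (fun t => h t ^ 2) = fun t => 2 * (h t * h' t) := funext fun t => (hd2 t).deriv
  have h1 : ContDiff ℝ 1 (fun t => h t ^ 2) := by
    rw [contDiff_one_iff_deriv, hder]
    exact ⟨fun t => (hd2 t).differentiableAt, by fun_prop⟩
  have h2 : HasCompactSupport (fun t => h t ^ 2) := hs.comp_left (g := fun s : ℝ => s ^ 2) (by simp)
  have := h2.integral_Iic_deriv_eq h1 x
  rw [hder] at this
  exact this.symm

theorem slice_bound {g k : ℝ × ℝ → ℝ} (hg : ContDiff ℝ (⊤ : ℕ∞) g) (hgs : HasCompactSupport g)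
    (hk : Continuous k) (hks : HasCompactSupport k) (hk0 : ∀ z, 0 ≤ k z)
    (h : ∀ t, ∫ y, 2 * (g (t, y) * pdx g (t, y)) ≤ ∫ y, k (t, y)) (x : ℝ) :
    ∫ y, g (x, y) ^ 2 ≤ ∫ z, k z := by
  have hpc : Continuous (pdx g) := (pd_smooth (1, 0) hg).continuous
  have hgc : Continuous g := hg.continuous
  set m : ℝ × ℝ → ℝ := fun z => 2 * (g z * pdx g z) with hm
  have hmc : Continuous m := by fun_prop
  have hms : HasCompactSupport m := (hgs.mul_right (f' := pdx g)).mul_left (f := fun _ => (2:ℝ))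
  have hmi : Integrable m (volume.prod volume) := hmc.integrable_of_hasCompactSupport hms
  have hki : Integrable k (volume.prod volume) := hk.integrable_of_hasCompactSupport hks
  have e1 : ∫ y, g (x, y) ^ 2 = ∫ y, ∫ t in Set.Iic x, m (t, y) := by
    congr 1; ext y
    exact sq_eq (fun t => hasDeriv_x hg t y) (by fun_prop) (slice_x_supp hgs y) x
  have hmr : Integrable m ((volume.restrict (Set.Iic x)).prod volume) := by
    have := hmi.restrict (s := Set.Iic x ×ˢ Set.univ)
    rwa [← Measure.prod_restrict, Measure.restrict_univ] at this
  have e2 : ∫ y, ∫ t in Set.Iic x, m (t, y) = ∫ t in Set.Iic x, ∫ y, m (t, y) :=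
    (integral_integral_swap (f := fun t y => m (t, y)) hmr).symm
  have e3 : ∫ t in Set.Iic x, ∫ y, m (t, y) ≤ ∫ t in Set.Iic x, ∫ y, k (t, y) :=
    integral_mono hmr.integral_prod_left hki.integral_prod_left.integrableOn h
  have e4 : ∫ t in Set.Iic x, ∫ y, k (t, y) ≤ ∫ t, ∫ y, k (t, y) :=
    setIntegral_le_integral hki.integral_prod_left
      (Filter.Eventually.of_forall fun t => integral_nonneg fun y => hk0 _)
  have e5 : ∫ t, ∫ y, k (t, y) = ∫ z, k z := (integral_prod k hki).symm
  linarith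

theorem sq_add_supp {a b : ℝ × ℝ → ℝ} (ha : HasCompactSupport a) (hb : HasCompactSupport b) :
    HasCompactSupport (fun z => a z ^ 2 + b z ^ 2) :=
  (ha.comp_left (g := fun s : ℝ => s ^ 2) (by simp)).add
    (hb.comp_left (g := fun s : ℝ => s ^ 2) (by simp))

theorem L2N_sq (f : ℝ × ℝ → ℝ) : ∫ z, f z ^ 2 = L2N f ^ 2 := by
  unfold L2N
  rw [← Real.sqrt_eq_rpow, Real.sq_sqrt (integral_nonneg fun z => sq_nonneg _)]

theorem L2N_nonneg (f : ℝ × ℝ → ℝ) : 0 ≤ L2N f :=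
  Real.rpow_nonneg (integral_nonneg fun z => sq_nonneg _) _

theorem int_sq_add {a b : ℝ × ℝ → ℝ} (hac : Continuous a) (hbc : Continuous b)
    (ha : HasCompactSupport a) (hb : HasCompactSupport b) :
    ∫ z, (a z ^ 2 + b z ^ 2) = L2N a ^ 2 + L2N b ^ 2 := by
  rw [integral_add, L2N_sq, L2N_sq]
  · exact Continuous.integrable_of_hasCompactSupport (by fun_prop)
      (ha.comp_left (g := fun s : ℝ => s ^ 2) (by simp))
  · exact Continuous.integrable_of_hasCompactSupport (by fun_prop)
      (hb.comp_left (g := fun s : ℝ => s ^ 2) (by simp))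

theorem stmt3 :
    ∃ C > 0, ∀ f : ℝ × ℝ → ℝ,
      ContDiff ℝ (⊤ : ℕ∞) f → HasCompactSupport f →
      ∀ z : ℝ × ℝ, |f z| ≤ C * (L2N f + L2N (pdx f) + L2N (pdy (pdy f))) := by
  refine ⟨2, by norm_num, fun f hf hs z => ?_⟩
  obtain ⟨x, y⟩ := z
  have hp : ContDiff ℝ (⊤ : ℕ∞) (pdx f) := pd_smooth _ hf
  have hq : ContDiff ℝ (⊤ : ℕ∞) (pdy f) := pd_smooth _ hf
  have hr : ContDiff ℝ (⊤ : ℕ∞) (pdy (pdy f)) := pd_smooth _ hq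
  have hw : ContDiff ℝ (⊤ : ℕ∞) (pdy (pdx f)) := pd_smooth _ hp
  have hps : HasCompactSupport (pdx f) := pd_supp _ hs
  have hqs : HasCompactSupport (pdy f) := pd_supp _ hs
  have hrs : HasCompactSupport (pdy (pdy f)) := pd_supp _ hqs
  have hws : HasCompactSupport (pdy (pdx f)) := pd_supp _ hps
  have cf := hf.continuous
  have cp := hp.continuous
  have cq := hq.continuous
  have cr := hr.continuous
  have cw := hw.continuous
  have b1 : ∫ y, f (x, y) ^ 2 ≤ ∫ z, (f z ^ 2 + pdx f z ^ 2) := by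
    refine slice_bound hf hs (by fun_prop) (sq_add_supp hs hps) (fun z => by positivity)
      (fun t => ?_) x
    refine integral_mono ?_ ?_ (fun y => ?_)
    · exact ((slice_y_int (g := fun z => f z * pdx f z) (by fun_prop) hs.mul_right t)).const_mul 2
    · exact slice_y_int (g := fun z => f z ^ 2 + pdx f z ^ 2) (by fun_prop) (sq_add_supp hs hps) t
    · show 2 * (f (t, y) * pdx f (t, y)) ≤ f (t, y) ^ 2 + pdx f (t, y) ^ 2
      nlinarith [sq_nonneg (f (t, y) - pdx f (t, y))]
  have b2 : ∫ y, pdy f (x, y) ^ 2 ≤ ∫ z, (pdx f z ^ 2 + pdy (pdy f) z ^ 2) := by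
    refine slice_bound hq hqs (by fun_prop) (sq_add_supp hps hrs) (fun z => by positivity)
      (fun t => ?_) x
    have ibp : ∫ y, pdy f (t, y) * pdy (pdx f) (t, y)
        = - ∫ y, pdy (pdy f) (t, y) * pdx f (t, y) :=
      integral_mul_deriv_eq_deriv_mul_of_integrable
        (fun y _ => hasDeriv_y hq t y) (fun y _ => hasDeriv_y hp t y)
        (slice_y_int (g := fun z => pdy f z * pdy (pdx f) z) (by fun_prop) hqs.mul_right t)
        (slice_y_int (g := fun z => pdy (pdy f) z * pdx f z) (by fun_prop) hrs.mul_right t)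
        (slice_y_int (g := fun z => pdy f z * pdx f z) (by fun_prop) hqs.mul_right t)
    simp_rw [pd_comm hf]
    rw [integral_const_mul, ibp, ← integral_neg, ← integral_const_mul]
    refine integral_mono ?_ ?_ (fun y => ?_)
    · exact ((slice_y_int (g := fun z => pdy (pdy f) z * pdx f z) (by fun_prop)
        hrs.mul_right t)).neg.const_mul 2
    · exact slice_y_int (g := fun z => pdx f z ^ 2 + pdy (pdy f) z ^ 2) (by fun_prop)
        (sq_add_supp hps hrs) t
    · show 2 * -(pdy (pdy f) (t, y) * pdx f (t, y)) ≤ pdx f (t, y) ^ 2 + pdy (pdy f) (t, y) ^ 2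
      nlinarith [sq_nonneg (pdx f (t, y) + pdy (pdy f) (t, y))]
  have sqi : ∀ {g : ℝ × ℝ → ℝ}, Continuous g → HasCompactSupport g →
      Integrable (fun y => g (x, y) ^ 2) := fun {g} hc hg =>
    slice_y_int (g := fun z => g z ^ 2) (by fun_prop)
      (hg.comp_left (g := fun s : ℝ => s ^ 2) (by simp)) x
  have b3 : f (x, y) ^ 2 ≤ (∫ y, f (x, y) ^ 2) + ∫ y, pdy f (x, y) ^ 2 := by
    rw [← integral_add (sqi cf hs) (sqi cq hqs),
      sq_eq (fun t => hasDeriv_y hf x t) (by fun_prop) (slice_y_supp hs x) y]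
    have hi : Integrable (fun y => f (x, y) ^ 2 + pdy f (x, y) ^ 2) := (sqi cf hs).add (sqi cq hqs)
    refine le_trans (integral_mono ?_ hi.integrableOn (fun t => ?_))
      (setIntegral_le_integral hi (Filter.Eventually.of_forall fun t => by
        show 0 ≤ f (x, t) ^ 2 + pdy f (x, t) ^ 2
        positivity))
    · exact ((slice_y_int (g := fun z => f z * pdy f z) (by fun_prop)
        hs.mul_right x)).const_mul 2 |>.integrableOn
    · show 2 * (f (x, t) * pdy f (x, t)) ≤ f (x, t) ^ 2 + pdy f (x, t) ^ 2
      nlinarith [sq_nonneg (f (x, t) - pdy f (x, t))]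
  rw [int_sq_add cf cp hs hps] at b1
  rw [int_sq_add cp cr hps hrs] at b2
  have n1 := L2N_nonneg f
  have n2 := L2N_nonneg (pdx f)
  have n3 := L2N_nonneg (pdy (pdy f))
  refine abs_le_of_sq_le_sq ?_ (by positivity)
  nlinarith [mul_nonneg n1 n2, mul_nonneg n1 n3, mul_nonneg n2 n3]
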